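/- arXiv:2110.12419 — 3 statements merged into one kernel-verified Lean document; each statement's English description precedes it below -/
import Mathlib

section
/- Let 𝕜 be an algebraically closed field of arbitrary characteristic, d ≥ 1 an integer, and b an integer with d + b ≥ 0. Then for every integer p with 0 ≤ p ≤ d + b, the Koszul cohomology group K_{p,2}(ℙ^1, O_{ℙ^1}(b); O_{ℙ^1}(d)) vanishes; concretely, the Koszul-type complex ⋀^{p+1}V ⊗ R_{1} → ⋀^{p}V ⊗ R_2 → ⋀^{p−1}V ⊗ R_{3} is exact at the middle term, i.e. the image of δ_{p+1,1} equals the kernel of δ_{p,2}. -/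
/-!
The base case of the asymptotic vanishing theorem:
`K_{p,2}(ℙ^1, O_{ℙ^1}(b); O_{ℙ^1}(d)) = 0` for `0 ≤ p ≤ d + b` (assuming `d + b ≥ 0`).
-/

open MvPolynomial TensorProduct

noncomputable section

/-- The family `v : Fin p → α` with its `i`-th entry omitted. -/
def omitFun {α : Type*} {p : ℕ} (v : Fin p → α) (i : Fin p) : Fin (p - 1) → α := fun j =>
  if (j : ℕ) < (i : ℕ) then v ⟨j, lt_of_lt_of_le j.isLt (Nat.sub_le p 1)⟩
  else v ⟨(j : ℕ) + 1, Nat.add_lt_of_lt_sub j.isLt⟩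

/-- The homogeneous component of degree `c ∈ ℤ` of a graded polynomial ring, where the
variable `x` has degree `w x`.  It is `0` if `c` is not attained (e.g. if `c < 0`). -/
def component (𝕜 : Type*) [Field 𝕜] {σ M : Type*} [AddCommMonoid M] (w : σ → M) (c : M) :
    Submodule 𝕜 (MvPolynomial σ 𝕜) :=
  weightedHomogeneousSubmodule 𝕜 w c

/-- Multiplication `T_{c₁} × T_{c₂} → T_{c₃}` between homogeneous components,
when `c₁ + c₂ = c₃`. -/
def componentMul (𝕜 : Type*) [Field 𝕜] {σ M : Type*} [AddCommMonoid M] (w : σ → M)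
    {c₁ c₂ c₃ : M} (h : c₁ + c₂ = c₃)
    (v : component 𝕜 w c₁) (f : component 𝕜 w c₂) : component 𝕜 w c₃ :=
  ⟨(v : MvPolynomial σ 𝕜) * (f : MvPolynomial σ 𝕜), by
    have hv : IsWeightedHomogeneous w (v : MvPolynomial σ 𝕜) c₁ :=
      (mem_weightedHomogeneousSubmodule _ _ _ _).1 v.2
    have hf : IsWeightedHomogeneous w (f : MvPolynomial σ 𝕜) c₂ :=
      (mem_weightedHomogeneousSubmodule _ _ _ _).1 f.2
    exact (mem_weightedHomogeneousSubmodule _ _ _ _).2 (h ▸ hv.mul hf)⟩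

/-- The element `v 0 ∧ v 1 ∧ ⋯ ∧ v (p-1)` of the `p`-th exterior power `⋀^p M`. -/
def wedge (𝕜 : Type*) [Field 𝕜] {M : Type*} [AddCommGroup M] [Module 𝕜 M] (p : ℕ)
    (v : Fin p → M) : ⋀[𝕜]^p M :=
  ⟨ExteriorAlgebra.ιMulti 𝕜 p v, ExteriorAlgebra.ιMulti_range 𝕜 p (Set.mem_range_self v)⟩

section KoszulComplex

variable {𝕜 V T : Type*} [Field 𝕜] [AddCommGroup V] [Module 𝕜 V] [CommRing T] [Algebra 𝕜 T]

/-- Left exterior multiplication by `v` on `⋀ V ⊗ T`. -/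
def wedgeLeft (v : V) : (ExteriorAlgebra 𝕜 V ⊗[𝕜] T) →ₗ[𝕜] (ExteriorAlgebra 𝕜 V ⊗[𝕜] T) :=
  (LinearMap.mulLeft 𝕜 (ExteriorAlgebra.ι 𝕜 v)).rTensor T

/-- Contraction by the linear form `ξ` on `⋀ V ⊗ T`. -/
def contract (ξ : Module.Dual 𝕜 V) :
    (ExteriorAlgebra 𝕜 V ⊗[𝕜] T) →ₗ[𝕜] (ExteriorAlgebra 𝕜 V ⊗[𝕜] T) :=
  (CliffordAlgebra.contractLeft ξ : ExteriorAlgebra 𝕜 V →ₗ[𝕜] ExteriorAlgebra 𝕜 V).rTensor T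

/-- The action of an endomorphism of `T` on `⋀ V ⊗ T`. -/
def coeffMap (g : T →ₗ[𝕜] T) :
    (ExteriorAlgebra 𝕜 V ⊗[𝕜] T) →ₗ[𝕜] (ExteriorAlgebra 𝕜 V ⊗[𝕜] T) :=
  g.lTensor (ExteriorAlgebra 𝕜 V)

/-- Multiplication by `f : T` on `⋀ V ⊗ T`. -/
def scale (f : T) : (ExteriorAlgebra 𝕜 V ⊗[𝕜] T) →ₗ[𝕜] (ExteriorAlgebra 𝕜 V ⊗[𝕜] T) :=
  coeffMap (LinearMap.mulLeft 𝕜 f)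

/-- The Koszul differential on `⋀ V ⊗ T` of the linear map `V → T` sending `b i` to `m i`. -/
def koszulDiff {n : ℕ} (b : Module.Basis (Fin n) 𝕜 V) (m : Fin n → T) :
    (ExteriorAlgebra 𝕜 V ⊗[𝕜] T) →ₗ[𝕜] (ExteriorAlgebra 𝕜 V ⊗[𝕜] T) :=
  ∑ i, scale (m i) ∘ₗ contract (b.coord i)

theorem wedgeLeft_tmul (v : V) (s : ExteriorAlgebra 𝕜 V) (t : T) :
    wedgeLeft v (s ⊗ₜ[𝕜] t) = (ExteriorAlgebra.ι 𝕜 v * s) ⊗ₜ t := rfl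

theorem contract_tmul (ξ : Module.Dual 𝕜 V) (s : ExteriorAlgebra 𝕜 V) (t : T) :
    contract ξ (s ⊗ₜ[𝕜] t) =
      (CliffordAlgebra.contractLeft ξ s : ExteriorAlgebra 𝕜 V) ⊗ₜ t := rfl

theorem scale_tmul (f : T) (s : ExteriorAlgebra 𝕜 V) (t : T) :
    scale f (s ⊗ₜ[𝕜] t) = s ⊗ₜ (f * t) := rfl

theorem coeffMap_wedgeLeft (g : T →ₗ[𝕜] T) (v : V) (x : ExteriorAlgebra 𝕜 V ⊗[𝕜] T) :
    coeffMap g (wedgeLeft v x) = wedgeLeft v (coeffMap g x) := by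
  induction x with
  | zero => simp
  | add x y hx hy => simp only [map_add, hx, hy]
  | tmul s t => rfl

theorem coeffMap_contract (g : T →ₗ[𝕜] T) (ξ : Module.Dual 𝕜 V)
    (x : ExteriorAlgebra 𝕜 V ⊗[𝕜] T) :
    coeffMap g (contract ξ x) = contract ξ (coeffMap g x) := by
  induction x with
  | zero => simp
  | add x y hx hy => simp only [map_add, hx, hy]
  | tmul s t => rfl

theorem coeffMap_coeffMap (g h : T →ₗ[𝕜] T) (x : ExteriorAlgebra 𝕜 V ⊗[𝕜] T) :
    coeffMap g (coeffMap h x) = coeffMap (g ∘ₗ h) x := by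
  induction x with
  | zero => simp
  | add x y hx hy => simp only [map_add, hx, hy]
  | tmul s t => rfl

theorem scale_wedgeLeft (f : T) (v : V) (x : ExteriorAlgebra 𝕜 V ⊗[𝕜] T) :
    scale f (wedgeLeft v x) = wedgeLeft v (scale f x) :=
  coeffMap_wedgeLeft _ v x

theorem scale_contract (f : T) (ξ : Module.Dual 𝕜 V) (x : ExteriorAlgebra 𝕜 V ⊗[𝕜] T) :
    scale f (contract ξ x) = contract ξ (scale f x) :=
  coeffMap_contract _ ξ x

theorem scale_scale (f g : T) (x : ExteriorAlgebra 𝕜 V ⊗[𝕜] T) :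
    scale f (scale g x) = scale (f * g) x := by
  induction x with
  | zero => simp
  | add x y hx hy => simp only [map_add, hx, hy]
  | tmul s t => simp only [scale_tmul, mul_assoc]

theorem scale_injective [IsDomain T] {f : T} (hf : f ≠ 0) :
    Function.Injective (scale f : (ExteriorAlgebra 𝕜 V ⊗[𝕜] T) →ₗ[𝕜] _) :=
  Module.Flat.lTensor_preserves_injective_linearMap _ (mul_right_injective₀ hf)

theorem contract_wedgeLeft (ξ : Module.Dual 𝕜 V) (v : V) (x : ExteriorAlgebra 𝕜 V ⊗[𝕜] T) :
    contract ξ (wedgeLeft v x) = ξ v • x - wedgeLeft v (contract ξ x) := by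
  induction x with
  | zero => simp
  | add x y hx hy => simp only [map_add, hx, hy, smul_add]; abel
  | tmul s t =>
    rw [wedgeLeft_tmul, contract_tmul, contract_tmul, wedgeLeft_tmul, TensorProduct.smul_tmul',
      ← TensorProduct.sub_tmul]
    exact congrArg (· ⊗ₜ[𝕜] t) (CliffordAlgebra.contractLeft_ι_mul _ v s)

theorem contract_contract (ξ : Module.Dual 𝕜 V) (x : ExteriorAlgebra 𝕜 V ⊗[𝕜] T) :
    contract ξ (contract ξ x) = 0 := by
  induction x with
  | zero => simp
  | add x y hx hy => simp only [map_add, hx, hy, add_zero]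
  | tmul s t =>
    rw [contract_tmul, contract_tmul, CliffordAlgebra.contractLeft_contractLeft,
      TensorProduct.zero_tmul]

theorem contract_comm (ξ η : Module.Dual 𝕜 V) (x : ExteriorAlgebra 𝕜 V ⊗[𝕜] T) :
    contract ξ (contract η x) = -contract η (contract ξ x) := by
  induction x with
  | zero => simp
  | add x y hx hy => simp only [map_add, hx, hy, neg_add]
  | tmul s t =>
    simp only [contract_tmul]
    rw [CliffordAlgebra.contractLeft_comm, TensorProduct.neg_tmul]

section Differential

variable {n : ℕ} (b : Module.Basis (Fin n) 𝕜 V) (m : Fin n → T)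

theorem koszulDiff_apply (x : ExteriorAlgebra 𝕜 V ⊗[𝕜] T) :
    koszulDiff b m x = ∑ i, scale (m i) (contract (b.coord i) x) := by
  simp [koszulDiff]

theorem contract_koszulDiff (ξ : Module.Dual 𝕜 V) (x : ExteriorAlgebra 𝕜 V ⊗[𝕜] T) :
    contract ξ (koszulDiff b m x) = -koszulDiff b m (contract ξ x) := by
  simp only [koszulDiff_apply, map_sum, ← Finset.sum_neg_distrib]
  refine Finset.sum_congr rfl fun i _ => ?_
  rw [← scale_contract, contract_comm, map_neg]

theorem scale_koszulDiff (f : T) (x : ExteriorAlgebra 𝕜 V ⊗[𝕜] T) :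
    scale f (koszulDiff b m x) = koszulDiff b m (scale f x) := by
  simp only [koszulDiff_apply, map_sum]
  refine Finset.sum_congr rfl fun i _ => ?_
  rw [scale_scale, ← scale_contract, scale_scale, mul_comm]

theorem sum_scale_smul (c : Fin n → 𝕜) (x : ExteriorAlgebra 𝕜 V ⊗[𝕜] T) :
    ∑ i, scale (m i) (c i • x) = scale (∑ i, c i • m i) x := by
  induction x with
  | zero => simp
  | add x y hx hy => simp only [map_add, smul_add, Finset.sum_add_distrib, hx, hy]
  | tmul s t =>
    simp only [map_smul, scale_tmul, Finset.sum_mul, TensorProduct.tmul_sum, smul_mul_assoc,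
      TensorProduct.tmul_smul]

theorem koszulDiff_wedgeLeft (v : V) (x : ExteriorAlgebra 𝕜 V ⊗[𝕜] T) :
    koszulDiff b m (wedgeLeft v x) =
      scale (∑ i, b.coord i v • m i) x - wedgeLeft v (koszulDiff b m x) := by
  simp only [koszulDiff_apply, contract_wedgeLeft, map_sub, Finset.sum_sub_distrib, map_sum,
    scale_wedgeLeft, sum_scale_smul]

theorem koszulDiff_wedgeLeft_basis (i : Fin n) (x : ExteriorAlgebra 𝕜 V ⊗[𝕜] T) :
    koszulDiff b m (wedgeLeft (b i) x) =
      scale (m i) x - wedgeLeft (b i) (koszulDiff b m x) := by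
  rw [koszulDiff_wedgeLeft]
  simp [Finsupp.single_apply]

theorem koszulDiff_algebraMap (r : 𝕜) (t : T) :
    koszulDiff b m (algebraMap 𝕜 (ExteriorAlgebra 𝕜 V) r ⊗ₜ t) = 0 := by
  rw [koszulDiff_apply]
  refine Finset.sum_eq_zero fun i _ => ?_
  rw [contract_tmul, CliffordAlgebra.contractLeft_algebraMap, TensorProduct.zero_tmul, map_zero]

theorem koszulDiff_koszulDiff (x : ExteriorAlgebra 𝕜 V ⊗[𝕜] T) :
    koszulDiff b m (koszulDiff b m x) = 0 := by
  induction x with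
  | zero => simp
  | add x y hx hy => simp only [map_add, hx, hy, add_zero]
  | tmul s t =>
    induction s using CliffordAlgebra.left_induction with
    | algebraMap r => rw [koszulDiff_algebraMap, map_zero]
    | add s s' hs hs' => simp only [TensorProduct.add_tmul, map_add, hs, hs', add_zero]
    | ι_mul s v hs =>
      change koszulDiff b m (koszulDiff b m (wedgeLeft v (s ⊗ₜ[𝕜] t))) = 0
      rw [koszulDiff_wedgeLeft, map_sub, koszulDiff_wedgeLeft, hs, map_zero, sub_zero,
        scale_koszulDiff, sub_self]

theorem koszulDiff_ιMulti_tmul (p : ℕ) (v : Fin p → V) (t : T) :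
    koszulDiff b m (ExteriorAlgebra.ιMulti 𝕜 p v ⊗ₜ t) =
      ∑ i : Fin p, ((-1 : 𝕜) ^ (i : ℕ)) •
        (ExteriorAlgebra.ιMulti 𝕜 (p - 1) (omitFun v i) ⊗ₜ[𝕜]
          ((∑ k, b.coord k (v i) • m k) * t)) := by
  induction p with
  | zero =>
    rw [ExteriorAlgebra.ιMulti_zero_apply, ← map_one (algebraMap 𝕜 _), koszulDiff_algebraMap]
    simp
  | succ p ih =>
    rw [ExteriorAlgebra.ιMulti_succ_apply, ← wedgeLeft_tmul, koszulDiff_wedgeLeft, ih,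
      Fin.sum_univ_succ, scale_tmul, map_sum, sub_eq_add_neg, ← Finset.sum_neg_distrib]
    congr 1
    · simp only [Fin.val_zero, pow_zero, one_smul]
      congr 2
    · refine Finset.sum_congr rfl fun i _ => ?_
      obtain ⟨q, rfl⟩ : ∃ q, p = q + 1 := ⟨p - 1, by have := i.pos; omega⟩
      rw [map_smul, wedgeLeft_tmul, Fin.val_succ, pow_succ, mul_neg_one, neg_smul]
      congr 2
      have h : Matrix.vecTail (omitFun v i.succ) = omitFun (Matrix.vecTail v) i := by
        funext j
        simp only [Matrix.vecTail, omitFun, Function.comp_apply, Fin.val_succ,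
          Nat.add_lt_add_iff_right]
        rfl
      rw [← h]
      exact congrArg (· ⊗ₜ[𝕜] _)
        (ExteriorAlgebra.ιMulti_succ_apply (n := q) (omitFun v i.succ)).symm

end Differential

section Grading

/-- The image of `⋀^p V ⊗ U` in `⋀ V ⊗ T`. -/
def exteriorPart (V : Type*) [AddCommGroup V] [Module 𝕜 V] (p : ℕ) (U : Submodule 𝕜 T) :
    Submodule 𝕜 (ExteriorAlgebra 𝕜 V ⊗[𝕜] T) :=
  LinearMap.range (TensorProduct.mapIncl (⋀[𝕜]^p V) U)

theorem tmul_mem_exteriorPart {p : ℕ} {U : Submodule 𝕜 T} {s : ExteriorAlgebra 𝕜 V}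
    (hs : s ∈ ⋀[𝕜]^p V) {t : T} (ht : t ∈ U) : s ⊗ₜ[𝕜] t ∈ exteriorPart V p U :=
  ⟨⟨s, hs⟩ ⊗ₜ ⟨t, ht⟩, rfl⟩

theorem exteriorPart_le {p : ℕ} {U : Submodule 𝕜 T}
    {S : Submodule 𝕜 (ExteriorAlgebra 𝕜 V ⊗[𝕜] T)}
    (h : ∀ s ∈ ⋀[𝕜]^p V, ∀ t ∈ U, s ⊗ₜ[𝕜] t ∈ S) : exteriorPart V p U ≤ S := by
  rintro _ ⟨x, rfl⟩
  induction x with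
  | zero => simp
  | add x y hx hy => rw [map_add]; exact S.add_mem hx hy
  | tmul s t => exact h _ s.2 _ t.2

theorem wedgeLeft_mem {p : ℕ} {U : Submodule 𝕜 T} (v : V) {x : ExteriorAlgebra 𝕜 V ⊗[𝕜] T}
    (hx : x ∈ exteriorPart V p U) : wedgeLeft v x ∈ exteriorPart V (p + 1) U := by
  refine exteriorPart_le (S := (exteriorPart V (p + 1) U).comap (wedgeLeft v))
    (fun s hs t ht => tmul_mem_exteriorPart ?_ ht) hx
  rw [ExteriorAlgebra.exteriorPower, pow_succ']
  exact Submodule.mul_mem_mul (LinearMap.mem_range_self _ v) hs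

theorem coeffMap_mem {p : ℕ} {U U' : Submodule 𝕜 T} {g : T →ₗ[𝕜] T} (hg : ∀ t ∈ U, g t ∈ U')
    {x : ExteriorAlgebra 𝕜 V ⊗[𝕜] T} (hx : x ∈ exteriorPart V p U) :
    coeffMap g x ∈ exteriorPart V p U' :=
  exteriorPart_le (S := (exteriorPart V p U').comap (coeffMap g))
    (fun _ hs t ht => tmul_mem_exteriorPart hs (hg t ht)) hx

theorem contract_eq_zero {U : Submodule 𝕜 T} (ξ : Module.Dual 𝕜 V)
    {x : ExteriorAlgebra 𝕜 V ⊗[𝕜] T} (hx : x ∈ exteriorPart V 0 U) : contract ξ x = 0 := by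
  refine exteriorPart_le (S := LinearMap.ker (contract ξ)) (fun s hs t _ => ?_) hx
  rw [ExteriorAlgebra.exteriorPower, pow_zero, Submodule.mem_one] at hs
  obtain ⟨r, rfl⟩ := hs
  rw [LinearMap.mem_ker, contract_tmul, CliffordAlgebra.contractLeft_algebraMap,
    TensorProduct.zero_tmul]

theorem contractLeft_mem_exteriorPower (ξ : Module.Dual 𝕜 V) (p : ℕ) :
    ∀ s ∈ ⋀[𝕜]^(p + 1) V,
      (CliffordAlgebra.contractLeft ξ s : ExteriorAlgebra 𝕜 V) ∈ ⋀[𝕜]^p V := by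
  induction p with
  | zero =>
    intro s hs
    rw [ExteriorAlgebra.exteriorPower, zero_add, pow_one] at hs
    obtain ⟨v, rfl⟩ := hs
    rw [ExteriorAlgebra.exteriorPower, pow_zero, Submodule.mem_one]
    exact ⟨ξ v, (CliffordAlgebra.contractLeft_ι _ _ v).symm⟩
  | succ p ih =>
    intro s hs
    rw [ExteriorAlgebra.exteriorPower, pow_succ'] at hs
    induction hs using Submodule.mul_induction_on' with
    | mem_mul_mem v hv s hs =>
      obtain ⟨v, rfl⟩ := hv
      have h : (CliffordAlgebra.contractLeft ξ (ExteriorAlgebra.ι 𝕜 v * s) :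
          ExteriorAlgebra 𝕜 V) = ξ v • s - ExteriorAlgebra.ι 𝕜 v *
            (CliffordAlgebra.contractLeft ξ s : ExteriorAlgebra 𝕜 V) :=
        CliffordAlgebra.contractLeft_ι_mul _ v s
      rw [h]
      refine Submodule.sub_mem _ (Submodule.smul_mem _ _ hs) ?_
      rw [ExteriorAlgebra.exteriorPower, pow_succ']
      exact Submodule.mul_mem_mul (LinearMap.mem_range_self _ v) (ih s hs)
    | add x _ y _ hx hy => rw [map_add]; exact Submodule.add_mem _ hx hy

theorem contract_mem {p : ℕ} {U : Submodule 𝕜 T} (ξ : Module.Dual 𝕜 V)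
    {x : ExteriorAlgebra 𝕜 V ⊗[𝕜] T} (hx : x ∈ exteriorPart V (p + 1) U) :
    contract ξ x ∈ exteriorPart V p U :=
  exteriorPart_le (S := (exteriorPart V p U).comap (contract ξ))
    (fun s hs _ ht => tmul_mem_exteriorPart (contractLeft_mem_exteriorPower ξ p s hs) ht) hx

theorem wedgeLeft_wedgeLeft (v : V) (x : ExteriorAlgebra 𝕜 V ⊗[𝕜] T) :
    wedgeLeft v (wedgeLeft v x) = 0 := by
  induction x with
  | zero => simp
  | add x y hx hy => simp only [map_add, hx, hy, add_zero]
  | tmul s t =>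
    rw [wedgeLeft_tmul, wedgeLeft_tmul, ← mul_assoc, ExteriorAlgebra.ι_sq_zero, zero_mul,
      TensorProduct.zero_tmul]

theorem wedgeLeft_add (v v' : V) (x : ExteriorAlgebra 𝕜 V ⊗[𝕜] T) :
    wedgeLeft (v + v') x = wedgeLeft v x + wedgeLeft v' x := by
  induction x with
  | zero => simp
  | add x y hx hy => simp only [map_add, hx, hy]; abel
  | tmul s t => simp only [wedgeLeft_tmul, map_add, add_mul, TensorProduct.add_tmul]

theorem wedgeLeft_anticomm (v v' : V) (x : ExteriorAlgebra 𝕜 V ⊗[𝕜] T) :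
    wedgeLeft v (wedgeLeft v' x) = -wedgeLeft v' (wedgeLeft v x) := by
  have h := wedgeLeft_wedgeLeft (v + v') x
  simp only [wedgeLeft_add, map_add, wedgeLeft_wedgeLeft, zero_add, add_zero] at h
  exact eq_neg_of_add_eq_zero_right h

theorem sum_wedgeLeft_eq_zero {n : ℕ} (b : Module.Basis (Fin n) 𝕜 V) (S : Finset (Fin n)) :
    ∀ y : Fin n → ExteriorAlgebra 𝕜 V ⊗[𝕜] T,
      (∀ i, contract (b.coord i) (∑ k ∈ S, wedgeLeft (b k) (y k)) = 0) →
      ∑ k ∈ S, wedgeLeft (b k) (y k) = 0 := by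
  induction S using Finset.induction_on with
  | empty => simp
  | insert a S ha ih =>
    intro y hy
    have hya : y a = wedgeLeft (b a) (contract (b.coord a) (y a)) +
        ∑ k ∈ S, wedgeLeft (b k) (contract (b.coord a) (y k)) := by
      have h := hy a
      rw [Finset.sum_insert ha, map_add, map_sum, contract_wedgeLeft, Finset.sum_congr rfl
        (g := fun k => -wedgeLeft (b k) (contract (b.coord a) (y k))) ?_] at h
      · rw [Finset.sum_neg_distrib, Module.Basis.coord_apply, Module.Basis.repr_self,
          Finsupp.single_eq_same, one_smul] at h
        rw [← sub_eq_zero, ← h]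
        abel
      · intro k hk
        have hka : a ≠ k := fun h => ha (h ▸ hk)
        rw [contract_wedgeLeft, Module.Basis.coord_apply, Module.Basis.repr_self,
          Finsupp.single_eq_of_ne hka, zero_smul, zero_sub]
    have h : ∑ k ∈ insert a S, wedgeLeft (b k) (y k) =
        ∑ k ∈ S, wedgeLeft (b k) (y k - wedgeLeft (b a) (contract (b.coord a) (y k))) := by
      rw [Finset.sum_insert ha]
      conv_lhs => rw [hya]
      rw [map_add, wedgeLeft_wedgeLeft, zero_add, map_sum, ← Finset.sum_add_distrib]
      refine Finset.sum_congr rfl fun k _ => ?_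
      rw [map_sub, wedgeLeft_anticomm (b a)]
      abel
    rw [h] at hy ⊢
    exact ih _ hy

theorem exists_eq_sum_wedgeLeft {n p : ℕ} (b : Module.Basis (Fin n) 𝕜 V) {U : Submodule 𝕜 T}
    {x : ExteriorAlgebra 𝕜 V ⊗[𝕜] T} (hx : x ∈ exteriorPart V (p + 1) U) :
    ∃ y : Fin n → ExteriorAlgebra 𝕜 V ⊗[𝕜] T, x = ∑ k, wedgeLeft (b k) (y k) := by
  let F : (Fin n → ExteriorAlgebra 𝕜 V ⊗[𝕜] T) →ₗ[𝕜] ExteriorAlgebra 𝕜 V ⊗[𝕜] T :=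
    ∑ k, wedgeLeft (b k) ∘ₗ LinearMap.proj k
  have hF : ∀ y, F y = ∑ k, wedgeLeft (b k) (y k) := fun y => by simp [F]
  suffices h : x ∈ LinearMap.range F by
    obtain ⟨y, hy⟩ := h
    exact ⟨y, by rw [← hy, hF]⟩
  refine exteriorPart_le (fun s hs t _ => ?_) hx
  rw [ExteriorAlgebra.exteriorPower, pow_succ'] at hs
  induction hs using Submodule.mul_induction_on' with
  | mem_mul_mem v hv s hs =>
    obtain ⟨v, rfl⟩ := hv
    refine ⟨fun k => b.coord k v • s ⊗ₜ t, ?_⟩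
    rw [hF]
    conv_rhs => rw [← b.sum_repr v, map_sum, Finset.sum_mul, TensorProduct.sum_tmul]
    refine Finset.sum_congr rfl fun k _ => ?_
    rw [map_smul, wedgeLeft_tmul, map_smul, smul_mul_assoc, TensorProduct.smul_tmul']
    rfl
  | add x _ y _ hx hy => rw [TensorProduct.add_tmul]; exact Submodule.add_mem _ hx hy

theorem eq_zero_of_contract_eq_zero {n p : ℕ} (b : Module.Basis (Fin n) 𝕜 V)
    {U : Submodule 𝕜 T} {x : ExteriorAlgebra 𝕜 V ⊗[𝕜] T} (hx : x ∈ exteriorPart V (p + 1) U)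
    (h : ∀ i, contract (b.coord i) x = 0) : x = 0 := by
  obtain ⟨y, rfl⟩ := exists_eq_sum_wedgeLeft b hx
  exact sum_wedgeLeft_eq_zero b _ y h

end Grading

end KoszulComplex

section BinaryForms

variable {𝕜 : Type*} [Field 𝕜]

/-- The binary forms of degree `c`. -/
abbrev binaryForms (𝕜 : Type*) [Field 𝕜] (c : ℤ) : Submodule 𝕜 (MvPolynomial (Fin 2) 𝕜) :=
  component 𝕜 (fun _ => (1 : ℤ)) c

/-- The monomials of degree `D` in two variables. -/
def binaryMonomial (𝕜 : Type*) [Field 𝕜] (D : ℕ) (i : Fin (D + 1)) : MvPolynomial (Fin 2) 𝕜 :=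
  X 0 ^ (D - i) * X 1 ^ (i : ℕ)

theorem binaryMonomial_eq (D : ℕ) (i : Fin (D + 1)) :
    binaryMonomial 𝕜 D i =
      monomial (Finsupp.single 0 (D - i : ℕ) + Finsupp.single 1 (i : ℕ)) 1 := by
  rw [binaryMonomial, X_pow_eq_monomial, X_pow_eq_monomial, monomial_mul, one_mul]

theorem weight_eq_add (s : Fin 2 →₀ ℕ) :
    Finsupp.weight (fun _ => (1 : ℤ)) s = s 0 + s 1 := by
  simp [Finsupp.weight_apply, Finsupp.sum_fintype]

theorem mem_binaryForms {c : ℤ} {f : MvPolynomial (Fin 2) 𝕜} :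
    f ∈ binaryForms 𝕜 c ↔ ∀ s, coeff s f ≠ 0 → (s 0 + s 1 : ℤ) = c := by
  simp_rw [← weight_eq_add]
  rfl

theorem monomial_mem_binaryForms {c : ℤ} {s : Fin 2 →₀ ℕ} (h : (s 0 + s 1 : ℤ) = c) (r : 𝕜) :
    monomial s r ∈ binaryForms 𝕜 c := by
  classical
  rw [mem_binaryForms]
  intro s' hs'
  rw [coeff_monomial] at hs'
  obtain rfl : s = s' := by by_contra hne; simp [hne] at hs'
  exact h

theorem mul_mem_binaryForms {c c' : ℤ} {f g : MvPolynomial (Fin 2) 𝕜} (hf : f ∈ binaryForms 𝕜 c)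
    (hg : g ∈ binaryForms 𝕜 c') : f * g ∈ binaryForms 𝕜 (c + c') :=
  (componentMul 𝕜 _ rfl ⟨f, hf⟩ ⟨g, hg⟩).2

theorem X_mem_binaryForms (k : Fin 2) : (X k : MvPolynomial (Fin 2) 𝕜) ∈ binaryForms 𝕜 1 :=
  isWeightedHomogeneous_X _ _ k

theorem binaryMonomial_mem (D : ℕ) (i : Fin (D + 1)) :
    binaryMonomial 𝕜 D i ∈ binaryForms 𝕜 D := by
  rw [binaryMonomial_eq]
  refine monomial_mem_binaryForms ?_ 1
  have := i.is_le
  simp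
  omega

/-- Division by the variable `X 0`, discarding the remainder. -/
def divX (𝕜 : Type*) [Field 𝕜] : MvPolynomial (Fin 2) 𝕜 →ₗ[𝕜] MvPolynomial (Fin 2) 𝕜 where
  toFun f := f.divMonomial (Finsupp.single 0 1)
  map_add' f g := add_divMonomial f g _
  map_smul' r f := by ext s; simp

theorem divX_mem {c : ℤ} {f : MvPolynomial (Fin 2) 𝕜} (hf : f ∈ binaryForms 𝕜 c) :
    divX 𝕜 f ∈ binaryForms 𝕜 (c - 1) := by
  rw [mem_binaryForms] at hf ⊢
  intro s hs
  have := hf (Finsupp.single 0 1 + s) hs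
  simp at this
  omega

theorem divX_X_mul (f : MvPolynomial (Fin 2) 𝕜) : divX 𝕜 (X 0 * f) = f :=
  X_mul_divMonomial 0 f

theorem divX_pow_mul (n : ℕ) (f : MvPolynomial (Fin 2) 𝕜) :
    divX 𝕜 (X 1 ^ n * f) = X 1 ^ n * divX 𝕜 f := by
  classical
  ext s
  have h : Finsupp.single (1 : Fin 2) n ≤ Finsupp.single 0 1 + s ↔ Finsupp.single 1 n ≤ s := by
    simp
  rw [X_pow_eq_monomial]
  change coeff (Finsupp.single 0 1 + s) (monomial (Finsupp.single 1 n) 1 * f) = _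
  rw [coeff_monomial_mul', coeff_monomial_mul']
  simp only [h]
  split_ifs with h'
  · change _ = 1 * coeff _ f
    rw [add_tsub_assoc_of_le h']
  · rfl

/-- The standard monomial basis of the space of binary forms of degree `D`. -/
def binaryFormsBasis (𝕜 : Type*) [Field 𝕜] (D : ℕ) :
    Module.Basis (Fin (D + 1)) 𝕜 (binaryForms 𝕜 D) :=
  Module.Basis.ofEquivFun
    { toFun := fun f i => coeff (Finsupp.single 0 (D - i : ℕ) + Finsupp.single 1 (i : ℕ))
        (f : MvPolynomial (Fin 2) 𝕜)
      map_add' := fun f g => by ext i; simp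
      map_smul' := fun r f => by ext i; simp
      invFun := fun a => ∑ i, a i • ⟨binaryMonomial 𝕜 D i, binaryMonomial_mem D i⟩
      left_inv := fun f => by
        classical
        refine Subtype.ext (MvPolynomial.ext _ _ fun s => ?_)
        simp only [AddSubmonoidClass.coe_finsetSum, Submodule.coe_smul, coeff_sum, coeff_smul,
          binaryMonomial_eq, coeff_monomial, smul_eq_mul, mul_ite, mul_one, mul_zero]
        by_cases hs : (s 0 + s 1 : ℤ) = D
        · have hs' : s 0 + s 1 = D := by exact_mod_cast hs
          have h : Finsupp.single 0 (D - s 1) + Finsupp.single 1 (s 1) = s := by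
            ext k
            fin_cases k <;> simp
            omega
          rw [Finset.sum_eq_single ⟨s 1, by omega⟩]
          · simp only [h, ↓reduceIte]
          · rintro i - hi
            refine if_neg fun h' => hi (Fin.ext ?_)
            simp [← h']
          · simp
        · have hf : coeff s (f : MvPolynomial (Fin 2) 𝕜) = 0 := by
            by_contra h
            exact hs (mem_binaryForms.1 f.2 s h)
          rw [hf]
          refine Finset.sum_eq_zero fun i _ => if_neg fun h => hs ?_
          have := i.is_le
          rw [← h]
          simp
          omega
      right_inv := fun a => by
        classical
        ext i
        simp only [AddSubmonoidClass.coe_finsetSum, Submodule.coe_smul, coeff_sum, coeff_smul,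
          binaryMonomial_eq, coeff_monomial, smul_eq_mul, mul_ite, mul_one, mul_zero]
        rw [Finset.sum_eq_single i]
        · simp
        · rintro k - hk
          refine if_neg fun h => hk (Fin.ext ?_)
          simpa using DFunLike.congr_fun h 1
        · simp }

theorem binaryFormsBasis_apply (D : ℕ) (i : Fin (D + 1)) :
    (binaryFormsBasis 𝕜 D i : MvPolynomial (Fin 2) 𝕜) = binaryMonomial 𝕜 D i := by
  rw [binaryFormsBasis, Module.Basis.coe_ofEquivFun]
  simp [Pi.single_apply]

theorem sum_coord_smul_binaryMonomial (D : ℕ) (v : binaryForms 𝕜 D) :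
    ∑ i, (binaryFormsBasis 𝕜 D).coord i v • binaryMonomial 𝕜 D i = v := by
  conv_rhs => rw [← (binaryFormsBasis 𝕜 D).sum_repr v]
  simp only [AddSubmonoidClass.coe_finsetSum, Submodule.coe_smul, binaryFormsBasis_apply]
  rfl

theorem X_one_mul_binaryMonomial {D k : ℕ} (hk : k < D) :
    X 1 * binaryMonomial 𝕜 D ⟨k, by omega⟩ = X 0 * binaryMonomial 𝕜 D ⟨k + 1, by omega⟩ := by
  obtain ⟨a, rfl⟩ : ∃ a, D = k + 1 + a := ⟨D - (k + 1), by omega⟩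
  simp only [binaryMonomial, show k + 1 + a - k = a + 1 by omega,
    show k + 1 + a - (k + 1) = a by omega]
  ring

theorem exists_monomial_eq_mul (D : ℕ) (s : Fin 2 →₀ ℕ) (hs : D ≤ s 0 + s 1) (r : 𝕜) :
    ∃ (i : Fin (D + 1)) (s' : Fin 2 →₀ ℕ), s' 0 + s' 1 + D = s 0 + s 1 ∧
      monomial s r = binaryMonomial 𝕜 D i * monomial s' r := by
  let i : Fin (D + 1) := ⟨D - min (s 0) D, by omega⟩
  refine ⟨i, s - (Finsupp.single 0 (D - i : ℕ) + Finsupp.single 1 (i : ℕ)), ?_, ?_⟩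
  · simp [i]
    omega
  · rw [binaryMonomial_eq, monomial_mul, one_mul, add_tsub_cancel_of_le]
    intro k
    fin_cases k <;> simp [i] <;> omega

end BinaryForms

section Exactness

variable {𝕜 V : Type*} [Field 𝕜] [AddCommGroup V] [Module 𝕜 V] {D : ℕ}
  (b : Module.Basis (Fin (D + 1)) 𝕜 V)

theorem scale_X_mem {p : ℕ} {c c' : ℤ} (h : c + 1 = c') (k : Fin 2)
    {x : ExteriorAlgebra 𝕜 V ⊗[𝕜] MvPolynomial (Fin 2) 𝕜}
    (hx : x ∈ exteriorPart V p (binaryForms 𝕜 c)) :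
    scale (X k) x ∈ exteriorPart V p (binaryForms 𝕜 c') :=
  coeffMap_mem (fun t ht => by
    rw [← h, add_comm]
    exact mul_mem_binaryForms (X_mem_binaryForms k) ht) hx

theorem scale_divX_eq {j : ℕ} {x y : ExteriorAlgebra 𝕜 V ⊗[𝕜] MvPolynomial (Fin 2) 𝕜}
    (h : scale (X 1 ^ j) x = scale (X 0) y) : scale (X 0) (coeffMap (divX 𝕜) x) = x := by
  have hcomm : ∀ z : ExteriorAlgebra 𝕜 V ⊗[𝕜] MvPolynomial (Fin 2) 𝕜,
      coeffMap (divX 𝕜) (scale (X 1 ^ j) z) = scale (X 1 ^ j) (coeffMap (divX 𝕜) z) := by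
    intro z
    rw [scale, coeffMap_coeffMap, coeffMap_coeffMap]
    exact congrArg (fun g => coeffMap g z) (LinearMap.ext (divX_pow_mul j))
  have hdiv : ∀ z : ExteriorAlgebra 𝕜 V ⊗[𝕜] MvPolynomial (Fin 2) 𝕜,
      coeffMap (divX 𝕜) (scale (X 0) z) = z := by
    intro z
    rw [scale, coeffMap_coeffMap, show divX 𝕜 ∘ₗ LinearMap.mulLeft 𝕜 (X 0) = LinearMap.id from
      LinearMap.ext divX_X_mul, coeffMap, LinearMap.lTensor_id, LinearMap.id_apply]
  refine scale_injective (pow_ne_zero j (X_ne_zero 1)) ?_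
  rw [scale_scale, mul_comm, ← scale_scale, ← hcomm, h, hdiv]

theorem one_tmul_mem_map_koszulDiff {c : ℤ} (hc : D ≤ c) {f : MvPolynomial (Fin 2) 𝕜}
    (hf : f ∈ binaryForms 𝕜 c) :
    (1 : ExteriorAlgebra 𝕜 V) ⊗ₜ[𝕜] f ∈
      (exteriorPart V 1 (binaryForms 𝕜 (c - D))).map (koszulDiff b (binaryMonomial 𝕜 D)) := by
  rw [f.as_sum, TensorProduct.tmul_sum]
  refine Submodule.sum_mem _ fun s hs => ?_
  have hsc := mem_binaryForms.1 hf s (mem_support_iff.1 hs)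
  obtain ⟨i, s', hs', h⟩ := exists_monomial_eq_mul D s (by omega) (coeff s f)
  refine ⟨wedgeLeft (b i) (1 ⊗ₜ monomial s' (coeff s f)),
    wedgeLeft_mem _ (tmul_mem_exteriorPart ?_ (monomial_mem_binaryForms (by omega) _)), ?_⟩
  · rw [ExteriorAlgebra.exteriorPower, pow_zero]
    exact Submodule.one_le.1 le_rfl
  · rw [koszulDiff_wedgeLeft_basis, ← map_one (algebraMap 𝕜 (ExteriorAlgebra 𝕜 V)),
      koszulDiff_algebraMap, map_zero, sub_zero, scale_tmul, h]

/-- Left multiplication by the Koszul cycle `b k ⊗ X 1 - b (k + 1) ⊗ X 0`. -/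
def wedgeCycle {k : ℕ} (hk : k < D) :
    (ExteriorAlgebra 𝕜 V ⊗[𝕜] MvPolynomial (Fin 2) 𝕜) →ₗ[𝕜]
      (ExteriorAlgebra 𝕜 V ⊗[𝕜] MvPolynomial (Fin 2) 𝕜) :=
  scale (X 1) ∘ₗ wedgeLeft (b ⟨k, by omega⟩) - scale (X 0) ∘ₗ wedgeLeft (b ⟨k + 1, by omega⟩)

theorem wedgeCycle_apply {k : ℕ} (hk : k < D)
    (x : ExteriorAlgebra 𝕜 V ⊗[𝕜] MvPolynomial (Fin 2) 𝕜) :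
    wedgeCycle b hk x = scale (X 1) (wedgeLeft (b ⟨k, by omega⟩) x) -
      scale (X 0) (wedgeLeft (b ⟨k + 1, by omega⟩) x) := rfl

theorem wedgeCycle_mem {k : ℕ} (hk : k < D) {p : ℕ} {c c' : ℤ} (h : c + 1 = c')
    {x : ExteriorAlgebra 𝕜 V ⊗[𝕜] MvPolynomial (Fin 2) 𝕜}
    (hx : x ∈ exteriorPart V p (binaryForms 𝕜 c)) :
    wedgeCycle b hk x ∈ exteriorPart V (p + 1) (binaryForms 𝕜 c') :=
  Submodule.sub_mem _ (scale_X_mem h _ (wedgeLeft_mem _ hx))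
    (scale_X_mem h _ (wedgeLeft_mem _ hx))

theorem koszulDiff_wedgeCycle {k : ℕ} (hk : k < D)
    (x : ExteriorAlgebra 𝕜 V ⊗[𝕜] MvPolynomial (Fin 2) 𝕜) :
    koszulDiff b (binaryMonomial 𝕜 D) (wedgeCycle b hk x) =
      -wedgeCycle b hk (koszulDiff b (binaryMonomial 𝕜 D) x) := by
  simp only [wedgeCycle_apply, map_sub, ← scale_koszulDiff, koszulDiff_wedgeLeft_basis, scale_scale,
    X_one_mul_binaryMonomial hk]
  abel

/-- A Koszul cycle not involving `b j, b (j + 1), …` is a boundary in high enough degree. -/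
theorem mem_map_koszulDiff_of_contract_eq_zero (j : ℕ) (hj : j ≤ D + 1) :
    ∀ (p : ℕ) (c : ℤ), p + D ≤ c → ∀ x ∈ exteriorPart V p (binaryForms 𝕜 c),
      (∀ i : Fin (D + 1), j ≤ i → contract (b.coord i) x = 0) →
      koszulDiff b (binaryMonomial 𝕜 D) x = 0 →
      x ∈ (exteriorPart V (p + 1) (binaryForms 𝕜 (c - D))).map
        (koszulDiff b (binaryMonomial 𝕜 D)) := by
  induction j with
  | zero =>
    intro p c hpc x hx hcon _
    cases p with
    | zero =>
      refine exteriorPart_le (fun s hs t ht => ?_) hx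
      rw [ExteriorAlgebra.exteriorPower, pow_zero, Submodule.mem_one] at hs
      obtain ⟨r, rfl⟩ := hs
      rw [Algebra.algebraMap_eq_smul_one, ← TensorProduct.smul_tmul']
      exact Submodule.smul_mem _ _ (one_tmul_mem_map_koszulDiff b (by simpa using hpc) ht)
    | succ p =>
      rw [eq_zero_of_contract_eq_zero b hx fun i => hcon i (Nat.zero_le _)]
      exact Submodule.zero_mem _
  | succ j ih =>
    specialize ih (by omega)
    intro p c hpc x hx hcon hdx
    let k : Fin (D + 1) := ⟨j, by omega⟩
    have ih_of_contract : contract (b.coord k) x = 0 →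
        x ∈ (exteriorPart V (p + 1) (binaryForms 𝕜 (c - D))).map
          (koszulDiff b (binaryMonomial 𝕜 D)) := by
      intro h
      refine ih p c hpc x hx (fun i hi => ?_) hdx
      rcases hi.eq_or_lt with hi | hi
      · rwa [show i = k from Fin.ext hi.symm]
      · exact hcon i hi
    cases p with
    | zero => exact ih_of_contract (contract_eq_zero _ hx)
    | succ p =>
      set β := contract (b.coord k) x with hβ
      have hβmem : β ∈ exteriorPart V p (binaryForms 𝕜 c) := contract_mem _ hx
      have hdβ : koszulDiff b (binaryMonomial 𝕜 D) β = 0 := by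
        rw [hβ, ← neg_eq_zero, ← contract_koszulDiff, hdx, map_zero]
      have hconβ : ∀ i : Fin (D + 1), j ≤ i → contract (b.coord i) β = 0 := by
        intro i hi
        rcases hi.eq_or_lt with hi | hi
        · rw [show i = k from Fin.ext hi.symm, hβ, contract_contract]
        · rw [hβ, contract_comm, hcon i hi, map_zero, neg_zero]
      set α := x - wedgeLeft (b k) β with hα
      have hconα : ∀ i : Fin (D + 1), j ≤ i → contract (b.coord i) α = 0 := by
        intro i hi
        rw [hα, map_sub, contract_wedgeLeft, hconβ i hi, map_zero, sub_zero,
          Module.Basis.coord_apply, Module.Basis.repr_self]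
        rcases hi.eq_or_lt with hi | hi
        · rw [show i = k from Fin.ext hi.symm, Finsupp.single_eq_same, one_smul, sub_self]
        · rw [hcon i hi, Finsupp.single_eq_of_ne, zero_smul, sub_zero]
          exact fun h => hi.ne' (congrArg Fin.val h)
      have hdα : scale (binaryMonomial 𝕜 D k) β = -koszulDiff b (binaryMonomial 𝕜 D) α := by
        rw [hα, map_sub, koszulDiff_wedgeLeft_basis, hdx, hdβ, map_zero]
        abel
      cases j with
      | zero =>
        refine ih_of_contract (scale_injective (𝕜 := 𝕜) (f := binaryMonomial 𝕜 D k)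
          (mul_ne_zero (pow_ne_zero _ (X_ne_zero _)) (pow_ne_zero _ (X_ne_zero _))) ?_)
        rw [hdα, map_zero, neg_eq_zero, koszulDiff_apply]
        exact Finset.sum_eq_zero fun i _ => by rw [hconα i (Nat.zero_le _), map_zero]
      | succ j =>
        have hjD : j < D := by omega
        obtain ⟨γ, hγ⟩ : ∃ γ, koszulDiff b (binaryMonomial 𝕜 D) α = scale (X 0 ^ (D - j)) γ := by
          refine ⟨∑ i : Fin (D + 1), scale (X 0 ^ (j - i : ℕ) * X 1 ^ (i : ℕ))
            (contract (b.coord i) α), ?_⟩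
          rw [koszulDiff_apply, map_sum]
          refine Finset.sum_congr rfl fun i _ => ?_
          by_cases hi : j + 1 ≤ i
          · simp only [hconα i hi, map_zero]
          · rw [scale_scale, binaryMonomial, ← mul_assoc, ← pow_add]
            congr 4
            omega
        have hdiv : scale (X 1 ^ (j + 1)) β = scale (X 0) (-γ) := by
          refine scale_injective (𝕜 := 𝕜) (pow_ne_zero (D - (j + 1)) (X_ne_zero (0 : Fin 2))) ?_
          rw [scale_scale, scale_scale, ← pow_succ, map_neg, show D - (j + 1) + 1 = D - j by omega,
            ← hγ, ← hdα]
          rfl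
        set β' := coeffMap (divX 𝕜) β with hβ'
        have hββ' : scale (X 0) β' = β := scale_divX_eq hdiv
        have hβ'mem : β' ∈ exteriorPart V p (binaryForms 𝕜 (c - 1)) :=
          coeffMap_mem (fun t ht => divX_mem ht) hβmem
        have hconβ' : ∀ i : Fin (D + 1), j + 1 ≤ i → contract (b.coord i) β' = 0 := by
          intro i hi
          rw [hβ', ← coeffMap_contract, hconβ i hi, map_zero]
        have hdβ' : koszulDiff b (binaryMonomial 𝕜 D) β' = 0 := by
          refine scale_injective (𝕜 := 𝕜) (X_ne_zero (0 : Fin 2)) ?_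
          rw [scale_koszulDiff, hββ', hdβ, map_zero]
        obtain ⟨η, hη, hdη⟩ := ih p (c - 1) (by push_cast at hpc; omega) β' hβ'mem hconβ' hdβ'
        have hsum : x + wedgeCycle b hjD β' =
            α + scale (X 1) (wedgeLeft (b ⟨j, by omega⟩) β') := by
          rw [wedgeCycle_apply, scale_wedgeLeft (X 0), hββ', hα]
          abel
        have hmem : x + wedgeCycle b hjD β' ∈
            (exteriorPart V (p + 1 + 1) (binaryForms 𝕜 (c - D))).map
              (koszulDiff b (binaryMonomial 𝕜 D)) := by
          refine ih (p + 1) c hpc _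
            (Submodule.add_mem _ hx (wedgeCycle_mem b hjD (by ring) hβ'mem)) (fun i hi => ?_) ?_
          · have hij : i ≠ ⟨j, by omega⟩ := by
              intro h
              have := congrArg Fin.val h
              simp only at this
              omega
            rw [hsum, map_add, hconα i hi, ← scale_contract, contract_wedgeLeft, hconβ' i hi,
              Module.Basis.coord_apply, Module.Basis.repr_self, Finsupp.single_eq_of_ne hij]
            simp
          · rw [map_add, hdx, koszulDiff_wedgeCycle, hdβ']
            simp
        have hcycle : wedgeCycle b hjD β' ∈
            (exteriorPart V (p + 1 + 1) (binaryForms 𝕜 (c - D))).map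
              (koszulDiff b (binaryMonomial 𝕜 D)) := by
          refine ⟨-wedgeCycle b hjD η,
            Submodule.neg_mem _ (wedgeCycle_mem b hjD (by ring) hη), ?_⟩
          rw [map_neg, koszulDiff_wedgeCycle, hdη, neg_neg]
        rw [← add_sub_cancel_right x (wedgeCycle b hjD β')]
        exact Submodule.sub_mem _ hmem hcycle

/-- The inclusion of `⋀^p V ⊗ U` into `⋀ V ⊗ T` intertwines the Koszul differentials. -/
theorem mapIncl_koszul {p : ℕ} {c c' : ℤ} (h : (D : ℤ) + c = c')
    (δ : ((⋀[𝕜]^p (binaryForms 𝕜 D)) ⊗[𝕜] (binaryForms 𝕜 c)) →ₗ[𝕜]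
      ((⋀[𝕜]^(p - 1) (binaryForms 𝕜 D)) ⊗[𝕜] (binaryForms 𝕜 c')))
    (hδ : ∀ (v : Fin p → binaryForms 𝕜 D) (f : binaryForms 𝕜 c),
      δ (wedge 𝕜 p v ⊗ₜ[𝕜] f) = ∑ i : Fin p, ((-1 : 𝕜) ^ (i : ℕ)) •
        (wedge 𝕜 (p - 1) (omitFun v i) ⊗ₜ[𝕜] componentMul 𝕜 _ h (v i) f))
    (x : (⋀[𝕜]^p (binaryForms 𝕜 D)) ⊗[𝕜] (binaryForms 𝕜 c)) :
    TensorProduct.mapIncl _ _ (δ x) =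
      koszulDiff (binaryFormsBasis 𝕜 D) (binaryMonomial 𝕜 D) (TensorProduct.mapIncl _ _ x) := by
  induction x with
  | zero => simp only [map_zero]
  | add x y hx hy => simp only [map_add, hx, hy]
  | tmul s f =>
    have hs : s ∈ Submodule.span 𝕜 (Set.range (exteriorPower.ιMulti 𝕜 p)) := by
      rw [exteriorPower.ιMulti_span]
      exact Submodule.mem_top
    induction hs using Submodule.span_induction with
    | zero => simp only [TensorProduct.zero_tmul, map_zero]
    | add s s' _ _ hs hs' => simp only [TensorProduct.add_tmul, map_add, hs, hs']
    | smul r s _ hs => rw [← TensorProduct.smul_tmul', map_smul, map_smul, map_smul, map_smul, hs]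
    | mem s hs =>
      obtain ⟨v, rfl⟩ := hs
      change TensorProduct.mapIncl _ _ (δ (wedge 𝕜 p v ⊗ₜ[𝕜] f)) =
        koszulDiff _ _ (ExteriorAlgebra.ιMulti 𝕜 p v ⊗ₜ (f : MvPolynomial (Fin 2) 𝕜))
      rw [hδ, koszulDiff_ιMulti_tmul, map_sum]
      refine Finset.sum_congr rfl fun i _ => ?_
      rw [map_smul, sum_coord_smul_binaryMonomial]
      rfl

theorem mapIncl_injective (p : ℕ) (c : ℤ) :
    Function.Injective (TensorProduct.mapIncl (⋀[𝕜]^p V) (binaryForms 𝕜 c)) :=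
  TensorProduct.map_injective_of_flat_flat _ _ (Submodule.injective_subtype _)
    (Submodule.injective_subtype _)

end Exactness

/-- **Vanishing of weight-two syzygies on `ℙ^1`.**
Let `𝕜` be an algebraically closed field, `d ≥ 1` an integer and `b` an integer with
`d + b ≥ 0`.  For every `0 ≤ p ≤ d + b`, the Koszul cohomology group
`K_{p,2}(ℙ^1, O_{ℙ^1}(b); O_{ℙ^1}(d))` vanishes, i.e. the Koszul-type complex
`⋀^{p+1}V ⊗ R_1 → ⋀^{p}V ⊗ R_2 → ⋀^{p-1}V ⊗ R_3` is exact at the middle term, where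
`T = 𝕜[x_0, x_1]` is the standard graded polynomial ring, `V = T_d` and `R_q = T_{b+qd}`. -/
theorem asymptotic_vanishing_syzygies_P1
    (𝕜 : Type*) [Field 𝕜] [IsAlgClosed 𝕜]
    (d : ℤ) (hd : 1 ≤ d) (b : ℤ) (hdb : 0 ≤ d + b)
    (p : ℕ) (hp : (p : ℤ) ≤ d + b)
    -- the weight function giving the standard grading of `T = 𝕜[x_0, x_1]`
    (w : Fin 2 → ℤ) (hw : ∀ x, w x = 1)
    -- the Koszul differential `δ_{p+1,1} : ⋀^{p+1} V ⊗ R_1 → ⋀^p V ⊗ R_2`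
    (δ₁ : ((⋀[𝕜]^(p + 1) (component 𝕜 w d)) ⊗[𝕜] (component 𝕜 w (b + 1 * d))) →ₗ[𝕜]
        ((⋀[𝕜]^p (component 𝕜 w d)) ⊗[𝕜] (component 𝕜 w (b + 2 * d))))
    (hδ₁ : ∀ (v : Fin (p + 1) → (component 𝕜 w d)) (f : component 𝕜 w (b + 1 * d)),
        δ₁ (wedge 𝕜 (p + 1) v ⊗ₜ[𝕜] f) =
          ∑ i : Fin (p + 1), ((-1 : 𝕜) ^ (i : ℕ)) •
            (wedge 𝕜 p (omitFun v i) ⊗ₜ[𝕜] componentMul 𝕜 w (by ring) (v i) f))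
    -- the Koszul differential `δ_{p,2} : ⋀^{p} V ⊗ R_2 → ⋀^{p-1} V ⊗ R_3`
    (δ₂ : ((⋀[𝕜]^p (component 𝕜 w d)) ⊗[𝕜] (component 𝕜 w (b + 2 * d))) →ₗ[𝕜]
        ((⋀[𝕜]^(p - 1) (component 𝕜 w d)) ⊗[𝕜] (component 𝕜 w (b + 3 * d))))
    (hδ₂ : ∀ (v : Fin p → (component 𝕜 w d)) (f : component 𝕜 w (b + 2 * d)),
        δ₂ (wedge 𝕜 p v ⊗ₜ[𝕜] f) =
          ∑ i : Fin p, ((-1 : 𝕜) ^ (i : ℕ)) •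
            (wedge 𝕜 (p - 1) (omitFun v i) ⊗ₜ[𝕜] componentMul 𝕜 w (by ring) (v i) f)) :
    LinearMap.range δ₁ = LinearMap.ker δ₂ := by
  obtain rfl : w = fun _ => 1 := funext hw
  obtain ⟨D, rfl⟩ := Int.eq_ofNat_of_zero_le (by omega : 0 ≤ d)
  have h₁ := mapIncl_koszul (p := p + 1) (by ring) δ₁ hδ₁
  have h₂ := mapIncl_koszul (by ring) δ₂ hδ₂
  apply le_antisymm
  · rintro _ ⟨x, rfl⟩
    refine mapIncl_injective _ _ ?_
    rw [h₂, map_zero]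
    exact (congrArg _ (h₁ x)).trans (koszulDiff_koszulDiff _ _ _)
  · intro x hx
    have key := mem_map_koszulDiff_of_contract_eq_zero (binaryFormsBasis 𝕜 D)
      (D + 1) le_rfl p (b + 2 * D) (by omega) (TensorProduct.mapIncl _ _ x) ⟨x, rfl⟩
      (fun i hi => absurd i.isLt (by omega)) (by rw [← h₂, LinearMap.mem_ker.1 hx, map_zero])
    rw [show b + 2 * (D : ℤ) - D = b + 1 * D by ring] at key
    obtain ⟨_, ⟨y, rfl⟩, hy⟩ := key
    exact ⟨y, mapIncl_injective _ _ ((h₁ y).trans hy)⟩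

end
end

section
/- Let 𝕜 be a field and let 0 → U → V → W → 0 be a short exact sequence of finite-dimensional 𝕜-vector spaces with dim W = 1, with surjection π : V → W. Then for every integer k ≥ 0 the sequence 0 → D^{k+1}U → D^{k+1}V → D^{k}V ⊗ W → 0 is exact, where: the first map is the restriction to D^{k+1}U of the inclusion U^{⊗(k+1)} ↪ V^{⊗(k+1)} (which carries D^{k+1}U into D^{k+1}V); and the second map is the restriction to D^{k+1}V of the map id_{V^{⊗k}} ⊗ π : V^{⊗(k+1)} = V^{⊗k} ⊗ V → V^{⊗k} ⊗ W, whose image on D^{k+1}V lies in D^{k}V ⊗ W. -/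
/-!
The short exact sequence of divided powers
`0 → D^{k+1}U → D^{k+1}V → D^{k}V ⊗ W → 0`
associated to a short exact sequence `0 → U → V → W → 0` with `dim W = 1`.
-/

open TensorProduct

noncomputable section

/-- The divided power `D^n M`: the subspace of `S_n`-invariant tensors in the `n`-th
tensor power `T^n M = M^{⊗n}`, the symmetric group acting by permuting the factors. -/
def dividedPower (𝕜 : Type*) [Field 𝕜] (M : Type*) [AddCommGroup M] [Module 𝕜 M] (n : ℕ) :
    Submodule 𝕜 (⨂[𝕜] _ : Fin n, M) where
  carrier := { ω | ∀ σ : Equiv.Perm (Fin n), PiTensorProduct.reindex 𝕜 (fun _ => M) σ ω = ω }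
  add_mem' := by
    intro a b ha hb σ
    rw [map_add, ha σ, hb σ]
  zero_mem' := by
    intro σ
    rw [map_zero]
  smul_mem' := by
    intro c a ha σ
    rw [map_smul, ha σ]

namespace DividedPower

open PiTensorProduct Module

section Multiset

variable {α J : Type*} [Fintype α]

theorem exists_perm_comp_eq_of_map_univ_eq {f g : α → J}
    (h : Finset.univ.val.map f = Finset.univ.val.map g) :
    ∃ σ : Equiv.Perm α, g ∘ σ = f := by
  classical
  have key (c : J) : Nonempty ({a // f a = c} ≃ {a // g a = c}) := by
    have hc := congrArg (Multiset.count c) h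
    rw [Multiset.count_map, Multiset.count_map] at hc
    refine ⟨Fintype.equivOfCardEq ?_⟩
    rw [Fintype.card_subtype, Fintype.card_subtype]
    simpa [Finset.card_def, Finset.filter_val, eq_comm] using hc
  exact ⟨Equiv.ofFiberEquiv fun c => (key c).some,
    funext fun a => Equiv.ofFiberEquiv_map _ a⟩

theorem map_univ_comp_perm (f : α → J) (σ : Equiv.Perm α) :
    Finset.univ.val.map (f ∘ σ) = Finset.univ.val.map f := by
  rw [← Multiset.map_map, Multiset.map_univ_val_equiv]

theorem map_univ_snoc {n : ℕ} (f : Fin n → J) (j : J) :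
    Finset.univ.val.map (Fin.snoc f j : Fin (n + 1) → J) = j ::ₘ Finset.univ.val.map f := by
  rw [Fin.univ_val_map, Fin.univ_val_map, List.ofFn_succ', List.concat_eq_append,
    ← Multiset.coe_add, add_comm]
  simp

/-- A symmetric function of `n` variables extends to a symmetric function of `n + 1` variables
by inserting the value `j` as an extra variable, and by zero away from `j`. -/
theorem exists_symmetric_extension {R : Type*} [Zero R] {n : ℕ} (j : J)
    (c : (Fin n → J) → R) (hc : ∀ (σ : Equiv.Perm (Fin n)) f, c (f ∘ σ) = c f) :
    ∃ d : (Fin (n + 1) → J) → R,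
      (∀ (σ : Equiv.Perm (Fin (n + 1))) f, d (f ∘ σ) = d f) ∧ ∀ f, d (Fin.snoc f j) = c f := by
  classical
  let S (s : Multiset J) (r : R) : Prop := ∃ f, j ::ₘ Finset.univ.val.map f = s ∧ c f = r
  refine ⟨fun f => if h : ∃ r, S (Finset.univ.val.map f) r then h.choose else 0,
    fun σ f => by simp only [map_univ_comp_perm], fun f => ?_⟩
  have h : ∃ r, S (Finset.univ.val.map (Fin.snoc f j : Fin (n + 1) → J)) r :=
    ⟨c f, f, (map_univ_snoc f j).symm, rfl⟩
  refine (dif_pos h).trans ?_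
  obtain ⟨g, hg, hgc⟩ := h.choose_spec
  rw [map_univ_snoc, Multiset.cons_inj_right] at hg
  obtain ⟨σ, rfl⟩ := exists_perm_comp_eq_of_map_univ_eq hg
  rw [← hgc, hc]

end Multiset

section Coordinates

variable {𝕜 M N : Type*} [Field 𝕜] [AddCommGroup M] [Module 𝕜 M] [AddCommGroup N] [Module 𝕜 N]
  {J : Type*}

/-- The basis of `T^n M` given by the tensor products of vectors of a basis of `M`. -/
def tensorBasis (b : Basis J 𝕜 M) (n : ℕ) : Basis (Fin n → J) 𝕜 (⨂[𝕜] _ : Fin n, M) :=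
  Basis.piTensorProduct fun _ => b

theorem tensorBasis_repr_tprod (b : Basis J 𝕜 M) {n : ℕ} (x : Fin n → M) (f : Fin n → J) :
    (tensorBasis b n).repr (tprod 𝕜 x) f = ∏ i, b.repr (x i) (f i) :=
  Basis.piTensorProduct_repr_tprod_apply _ _ _

theorem tensorBasis_repr_reindex (b : Basis J 𝕜 M) {n : ℕ} (σ : Equiv.Perm (Fin n))
    (ω : ⨂[𝕜] _ : Fin n, M) (f : Fin n → J) :
    (tensorBasis b n).repr (reindex 𝕜 (fun _ => M) σ ω) f =
      (tensorBasis b n).repr ω (f ∘ σ) := by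
  suffices (tensorBasis b n).coord f ∘ₗ (reindex 𝕜 (fun _ => M) σ).toLinearMap =
      (tensorBasis b n).coord (f ∘ σ) from DFunLike.congr_fun this ω
  refine PiTensorProduct.ext (MultilinearMap.ext fun x => ?_)
  simp only [LinearMap.compMultilinearMap_apply, LinearMap.comp_apply, LinearEquiv.coe_coe,
    Basis.coord_apply]
  erw [reindex_tprod, tensorBasis_repr_tprod, tensorBasis_repr_tprod]
  exact Fintype.prod_equiv σ.symm _ _ fun i => by simp

theorem mem_dividedPower_iff_repr (b : Basis J 𝕜 M) {n : ℕ} {ω : ⨂[𝕜] _ : Fin n, M} :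
    ω ∈ dividedPower 𝕜 M n ↔ ∀ (σ : Equiv.Perm (Fin n)) (f : Fin n → J),
      (tensorBasis b n).repr ω (f ∘ σ) = (tensorBasis b n).repr ω f := by
  refine forall_congr' fun σ => ⟨fun h f => ?_, fun h => ?_⟩
  · rw [← tensorBasis_repr_reindex, h]
  · exact (tensorBasis b n).ext_elem fun f => (tensorBasis_repr_reindex b σ ω f).trans (h f)

theorem map_mem_dividedPower (φ : M →ₗ[𝕜] N) {n : ℕ} {ω : ⨂[𝕜] _ : Fin n, M}
    (hω : ω ∈ dividedPower 𝕜 M n) : PiTensorProduct.map (fun _ => φ) ω ∈ dividedPower 𝕜 N n :=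
  fun σ => (map_reindex (fun _ => φ) σ ω).symm.trans
    (congrArg (PiTensorProduct.map fun _ => φ) (hω σ))

variable [Finite J]

/-- Contraction of the last tensor factor with the coordinate form `b.coord j`. -/
def contractLast (b : Basis J 𝕜 M) (j : J) (n : ℕ) :
    (⨂[𝕜] _ : Fin (n + 1), M) →ₗ[𝕜] ⨂[𝕜] _ : Fin n, M :=
  (tensorBasis b n).equivFun.symm.toLinearMap ∘ₗ
    LinearMap.funLeft 𝕜 𝕜 (fun f : Fin n → J => (Fin.snoc f j : Fin (n + 1) → J)) ∘ₗ
      (tensorBasis b (n + 1)).equivFun.toLinearMap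

theorem tensorBasis_repr_contractLast (b : Basis J 𝕜 M) (j : J) {n : ℕ}
    (ω : ⨂[𝕜] _ : Fin (n + 1), M) (f : Fin n → J) :
    (tensorBasis b n).repr (contractLast b j n ω) f =
      (tensorBasis b (n + 1)).repr ω (Fin.snoc f j) := by
  rw [← Basis.equivFun_apply]
  simp [contractLast, LinearMap.funLeft_apply]

theorem contractLast_tprod (b : Basis J 𝕜 M) (j : J) {n : ℕ} (x : Fin (n + 1) → M) :
    contractLast b j n (tprod 𝕜 x) =
      b.repr (x (Fin.last n)) j • tprod 𝕜 fun i : Fin n => x i.castSucc := by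
  refine (tensorBasis b n).ext_elem fun f => ?_
  rw [tensorBasis_repr_contractLast, map_smul, Finsupp.smul_apply, tensorBasis_repr_tprod,
    tensorBasis_repr_tprod, Fin.prod_univ_castSucc]
  simp [mul_comm]

theorem map_contractLast_dividedPower (b : Basis J 𝕜 M) (j : J) (n : ℕ) :
    (dividedPower 𝕜 M (n + 1)).map (contractLast b j n) = dividedPower 𝕜 M n := by
  apply le_antisymm
  · rintro _ ⟨ω, hω, rfl⟩
    have hω' := (mem_dividedPower_iff_repr b).1 hω
    refine (mem_dividedPower_iff_repr b).2 fun σ f => ?_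
    rw [tensorBasis_repr_contractLast, tensorBasis_repr_contractLast]
    have hσ : (Fin.snoc (f ∘ σ) j : Fin (n + 1) → J) =
        (Fin.snoc f j : Fin (n + 1) → J) ∘ (finSuccEquivLast.symm.permCongr σ.optionCongr) := by
      funext i
      refine Fin.lastCases ?_ (fun i => ?_) i <;> simp [Equiv.permCongr_apply]
    rw [hσ, hω']
  · intro z hz
    obtain ⟨d, hd, hdz⟩ := exists_symmetric_extension j _ ((mem_dividedPower_iff_repr b).1 hz)
    have hrepr (f) : (tensorBasis b (n + 1)).repr
        ((tensorBasis b (n + 1)).equivFun.symm d) f = d f := by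
      rw [← Basis.equivFun_apply, LinearEquiv.apply_symm_apply]
    refine ⟨(tensorBasis b (n + 1)).equivFun.symm d, ?_, ?_⟩
    · exact (mem_dividedPower_iff_repr b).2 fun σ f => by rw [hrepr, hrepr, hd]
    · exact (tensorBasis b n).ext_elem fun f => by
        rw [tensorBasis_repr_contractLast, hrepr, hdz]

/-- A symmetric tensor killed by contraction with `b.coord j` is fixed by any tensor power of
a projection along `b j` onto the span of the other basis vectors. -/
theorem map_eq_self_of_contractLast_eq_zero (b : Basis J 𝕜 M) (j : J) {n : ℕ}
    {ω : ⨂[𝕜] _ : Fin (n + 1), M} (hω : ω ∈ dividedPower 𝕜 M (n + 1))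
    (h : contractLast b j n ω = 0) (p : M →ₗ[𝕜] M)
    (hp : ∀ i ≠ j, ∀ v, b.repr (p v) i = b.repr v i) (hpj : ∀ v, b.repr (p v) j = 0) :
    PiTensorProduct.map (fun _ => p) ω = ω := by
  have hω' := (mem_dividedPower_iff_repr b).1 hω
  refine (tensorBasis b (n + 1)).ext_elem fun f => ?_
  by_cases hf : ∃ i, f i = j
  · obtain ⟨i, hi⟩ := hf
    have hl : (tensorBasis b (n + 1)).coord f ∘ₗ PiTensorProduct.map (fun _ => p) = 0 := by
      refine PiTensorProduct.ext (MultilinearMap.ext fun x => ?_)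
      simp only [LinearMap.compMultilinearMap_apply, LinearMap.comp_apply, Basis.coord_apply,
        map_tprod, tensorBasis_repr_tprod, LinearMap.zero_apply]
      exact Finset.prod_eq_zero (Finset.mem_univ i) (by rw [hi, hpj])
    refine (DFunLike.congr_fun hl ω).trans ?_
    rw [LinearMap.zero_apply, ← hω' (Equiv.swap i (Fin.last n)) f]
    have hs : f ∘ Equiv.swap i (Fin.last n) =
        Fin.snoc (fun l : Fin n => f (Equiv.swap i (Fin.last n) l.castSucc)) j := by
      funext l
      refine Fin.lastCases ?_ (fun l => ?_) l <;> simp [hi]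
    rw [hs, ← tensorBasis_repr_contractLast, h, map_zero, Finsupp.zero_apply]
  · have hl : (tensorBasis b (n + 1)).coord f ∘ₗ PiTensorProduct.map (fun _ => p) =
        (tensorBasis b (n + 1)).coord f := by
      refine PiTensorProduct.ext (MultilinearMap.ext fun x => ?_)
      simp only [LinearMap.compMultilinearMap_apply, LinearMap.comp_apply, Basis.coord_apply,
        map_tprod, tensorBasis_repr_tprod]
      exact Finset.prod_congr rfl fun i _ => hp _ (fun hi => hf ⟨i, hi⟩) _
    exact DFunLike.congr_fun hl ω

end Coordinates

theorem eq_zero_of_tmul_eq_zero {𝕜 M W : Type*} [Field 𝕜] [AddCommGroup M] [Module 𝕜 M]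
    [AddCommGroup W] [Module 𝕜 W] {z : M} {w : W} (hw : w ≠ 0) (h : z ⊗ₜ[𝕜] w = 0) : z = 0 := by
  have hinj := Module.Flat.lTensor_preserves_injective_linearMap (M := M)
    (LinearMap.toSpanSingleton 𝕜 W w) (smul_left_injective 𝕜 hw)
  have h1 : z ⊗ₜ[𝕜] (1 : 𝕜) = 0 := hinj (by simpa using h)
  simpa using congrArg (TensorProduct.rid 𝕜 M) h1

/-- A basis of `V` adapted to a short exact sequence `0 → U → V → W → 0` with `dim W = 1`:
its zeroth vector maps to a nonzero vector of `W`, and the others form a basis of `U`. -/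
theorem exists_adapted_basis {𝕜 U V W : Type*} [Field 𝕜] [AddCommGroup U] [Module 𝕜 U]
    [AddCommGroup V] [Module 𝕜 V] [AddCommGroup W] [Module 𝕜 W] [FiniteDimensional 𝕜 U]
    (ι : U →ₗ[𝕜] V) (π : V →ₗ[𝕜] W) (hι : Function.Injective ι) (hπ : Function.Surjective π)
    (hexact : LinearMap.range ι = LinearMap.ker π) (hW : finrank 𝕜 W = 1) :
    ∃ (m : ℕ) (a : Basis (Fin m) 𝕜 U) (b : Basis (Fin (m + 1)) 𝕜 V),
      π (b 0) ≠ 0 ∧ ∀ i, b i.succ = ι (a i) := by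
  obtain ⟨w, hw, hspan⟩ := finrank_eq_one_iff'.1 hW
  obtain ⟨v, rfl⟩ := hπ w
  let a := finBasis 𝕜 U
  have hker {x : V} : x ∈ LinearMap.range ι ↔ π x = 0 := by rw [hexact, LinearMap.mem_ker]
  refine ⟨_, a, Basis.mkFinCons v (a.map (LinearEquiv.ofInjective ι hι)) ?_ ?_, ?_, ?_⟩
  · intro c x hx h
    have := congrArg π h
    rw [map_add, hker.1 hx, map_smul, add_zero, map_zero] at this
    exact (smul_eq_zero.1 this).resolve_right hw
  · intro z
    obtain ⟨c, hc⟩ := hspan (π z)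
    exact ⟨-c, hker.2 (by rw [map_add, map_smul, neg_smul, hc, add_neg_cancel])⟩
  · simpa using hw
  · intro i
    simp

end DividedPower

/-- **The divided power short exact sequence.**
Let `0 → U → V → W → 0` be a short exact sequence of finite-dimensional vector spaces
over a field `𝕜`, with `dim W = 1`, with injection `ι : U → V` and surjection `π : V → W`.
For every `k ≥ 0`, the sequence `0 → D^{k+1}U → D^{k+1}V → D^{k}V ⊗ W → 0` is exact,
where the first map is the restriction to `D^{k+1}U` of `ι^{⊗(k+1)} : U^{⊗(k+1)} → V^{⊗(k+1)}`
(here the linear map `Φ`, characterized on elementary tensors by `hΦ`), which carries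
`D^{k+1}U` into `D^{k+1}V` (first conjunct), and the second map is the restriction to
`D^{k+1}V` of `id_{V^{⊗k}} ⊗ π : V^{⊗(k+1)} = V^{⊗k} ⊗ V → V^{⊗k} ⊗ W` (here the linear
map `Ψ`, characterized on elementary tensors by `hΨ`), whose image on `D^{k+1}V` is exactly
`D^{k}V ⊗ W` (third conjunct, which in particular contains surjectivity onto `D^kV ⊗ W`);
the second conjunct is injectivity of the first map on `D^{k+1}U`, and the fourth conjunct
is exactness at the middle term. -/
theorem dividedPower_short_exact_sequence
    (𝕜 : Type*) [Field 𝕜]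
    (U V W : Type*) [AddCommGroup U] [Module 𝕜 U] [AddCommGroup V] [Module 𝕜 V]
    [AddCommGroup W] [Module 𝕜 W]
    [FiniteDimensional 𝕜 U] [FiniteDimensional 𝕜 V] [FiniteDimensional 𝕜 W]
    (ι : U →ₗ[𝕜] V) (π : V →ₗ[𝕜] W)
    (hι : Function.Injective ι) (hπ : Function.Surjective π)
    (hexact : LinearMap.range ι = LinearMap.ker π)
    (hW : Module.finrank 𝕜 W = 1)
    (k : ℕ)
    -- `Φ` is the `(k+1)`-st tensor power of the inclusion `ι`
    (Φ : (⨂[𝕜] _ : Fin (k + 1), U) →ₗ[𝕜] (⨂[𝕜] _ : Fin (k + 1), V))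
    (hΦ : ∀ u : Fin (k + 1) → U,
      Φ (PiTensorProduct.tprod 𝕜 u) = PiTensorProduct.tprod 𝕜 (fun i => ι (u i)))
    -- `Ψ` is `id_{V^{⊗k}} ⊗ π` under the identification `V^{⊗(k+1)} = V^{⊗k} ⊗ V`
    (Ψ : (⨂[𝕜] _ : Fin (k + 1), V) →ₗ[𝕜] (⨂[𝕜] _ : Fin k, V) ⊗[𝕜] W)
    (hΨ : ∀ v : Fin (k + 1) → V,
      Ψ (PiTensorProduct.tprod 𝕜 v) =
        (PiTensorProduct.tprod 𝕜 (fun i : Fin k => v i.castSucc)) ⊗ₜ[𝕜] π (v (Fin.last k))) :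
    -- `Φ` carries `D^{k+1}U` into `D^{k+1}V`
    (Submodule.map Φ (dividedPower 𝕜 U (k + 1)) ≤ dividedPower 𝕜 V (k + 1)) ∧
    -- the first map `D^{k+1}U → D^{k+1}V` is injective
    (∀ x ∈ dividedPower 𝕜 U (k + 1), Φ x = 0 → x = 0) ∧
    -- the image of `D^{k+1}V` under `Ψ` is exactly `D^kV ⊗ W ⊆ V^{⊗k} ⊗ W`
    (Submodule.map Ψ (dividedPower 𝕜 V (k + 1)) =
      LinearMap.range (LinearMap.rTensor W (dividedPower 𝕜 V k).subtype)) ∧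
    -- exactness at the middle term `D^{k+1}V`
    (∀ y ∈ dividedPower 𝕜 V (k + 1),
      (Ψ y = 0 ↔ y ∈ Submodule.map Φ (dividedPower 𝕜 U (k + 1)))) := by
  obtain ⟨m, a, b, hw, hb⟩ := DividedPower.exists_adapted_basis ι π hι hπ hexact hW
  have hπι (u : U) : π (ι u) = 0 := by
    have : ι u ∈ LinearMap.ker π := hexact ▸ LinearMap.mem_range_self ι u
    exact this
  have hπb (v : V) : π v = b.repr v 0 • π (b 0) := by
    suffices π = (b.coord 0).smulRight (π (b 0)) from DFunLike.congr_fun this v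
    refine b.ext fun i => ?_
    refine Fin.cases ?_ (fun i => ?_) i
    · simp
    · rw [hb, hπι, ← hb]; simp
  have hΦ' : Φ = PiTensorProduct.map fun _ => ι :=
    PiTensorProduct.ext (MultilinearMap.ext fun u => by simp [hΦ])
  have hΨ' (y : ⨂[𝕜] _ : Fin (k + 1), V) :
      Ψ y = DividedPower.contractLast b 0 k y ⊗ₜ[𝕜] π (b 0) := by
    suffices Ψ = (TensorProduct.mk 𝕜 _ W).flip (π (b 0)) ∘ₗ DividedPower.contractLast b 0 k from
      DFunLike.congr_fun this y
    refine PiTensorProduct.ext (MultilinearMap.ext fun v => ?_)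
    simp only [LinearMap.compMultilinearMap_apply, LinearMap.comp_apply, hΨ,
      DividedPower.contractLast_tprod, LinearMap.flip_apply, TensorProduct.mk_apply]
    rw [hπb, TensorProduct.smul_tmul]
  let r : V →ₗ[𝕜] U := b.constr 𝕜 (Fin.cons 0 a)
  have hrι : r ∘ₗ ι = LinearMap.id := a.ext fun i => by
    simp only [LinearMap.comp_apply, ← hb, r, Module.Basis.constr_basis, Fin.cons_succ,
      LinearMap.id_apply]
  have hinj (x : ⨂[𝕜] _ : Fin (k + 1), U) : PiTensorProduct.map (fun _ => r) (Φ x) = x := by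
    rw [hΦ', ← LinearMap.comp_apply, ← PiTensorProduct.map_comp, hrι, PiTensorProduct.map_id,
      LinearMap.id_apply]
  refine ⟨?_, fun x _ hx => ?_, ?_, fun y hy => ⟨fun h => ?_, ?_⟩⟩
  · rintro _ ⟨x, hx, rfl⟩
    exact hΦ' ▸ DividedPower.map_mem_dividedPower ι hx
  · rw [← hinj x, hx, map_zero]
  · have hΨ_range (z : ⨂[𝕜] _ : Fin k, V) (hz : z ∈ dividedPower 𝕜 V k) (w : W) :
        z ⊗ₜ[𝕜] w ∈ Submodule.map Ψ (dividedPower 𝕜 V (k + 1)) := by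
      obtain ⟨v, rfl⟩ := hπ w
      rw [← DividedPower.map_contractLast_dividedPower b 0 k] at hz
      obtain ⟨y, hy, rfl⟩ := hz
      rw [hπb, TensorProduct.tmul_smul, ← hΨ']
      exact Submodule.smul_mem _ _ ⟨y, hy, rfl⟩
    apply le_antisymm
    · rintro _ ⟨y, hy, rfl⟩
      have hy' : DividedPower.contractLast b 0 k y ∈ dividedPower 𝕜 V k :=
        DividedPower.map_contractLast_dividedPower b 0 k ▸ Submodule.mem_map_of_mem hy
      exact ⟨⟨_, hy'⟩ ⊗ₜ π (b 0), by rw [hΨ', LinearMap.rTensor_tmul]; rfl⟩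
    · rintro _ ⟨t, rfl⟩
      induction t using TensorProduct.induction_on with
      | zero => rw [map_zero]; exact Submodule.zero_mem _
      | tmul z w => exact hΨ_range z z.2 w
      | add s t hs ht => rw [map_add]; exact Submodule.add_mem _ hs ht
  · rw [hΨ'] at h
    have h0 : DividedPower.contractLast b 0 k y = 0 :=
      DividedPower.eq_zero_of_tmul_eq_zero hw h
    refine ⟨PiTensorProduct.map (fun _ => r) y, DividedPower.map_mem_dividedPower r hy, ?_⟩
    rw [hΦ', ← LinearMap.comp_apply, ← PiTensorProduct.map_comp]
    have hp (i : Fin (m + 1)) (v : V) :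
        b.repr (ι (r v)) i = if i = 0 then 0 else b.repr v i := by
      suffices b.coord i ∘ₗ ι ∘ₗ r = if i = 0 then 0 else b.coord i by
        have hv := DFunLike.congr_fun this v
        split_ifs at hv ⊢ <;> exact hv
      refine b.ext fun l => ?_
      refine Fin.cases ?_ (fun l => ?_) l
      · split_ifs with hi <;> simp [r, eq_comm, hi]
      · have hl : ι (r (b l.succ)) = b l.succ := by
          rw [hb, ← LinearMap.comp_apply r, hrι, LinearMap.id_apply]
        split_ifs with hi <;> simp [hl, hi]
    exact DividedPower.map_eq_self_of_contractLast_eq_zero b 0 hy h0 (ι ∘ₗ r)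
      (fun i hi v => by simp [hp, hi]) (fun v => by simp [hp])
  · rintro ⟨x, -, rfl⟩
    suffices Ψ ∘ₗ Φ = 0 from DFunLike.congr_fun this x
    exact PiTensorProduct.ext (MultilinearMap.ext fun u => by simp [hΦ, hΨ, hπι])

end
end

section
/- Let N, n, q, d, d′, b, b′, p, i be integers satisfying: N ≥ 1, n ≥ 1, q ≥ 3, d ≥ 1, d′ ≥ d, b′ ≥ b, d + b ≥ 0, p ≥ 0, N·n!·p ≤ d^{q−1} + b·d^{q−2}, and N·(n−1)!·(i − q + 1) ≥ d^{q−2} + b·d^{q−3}. Then i·(d′ + n) + d′ + b′ + 2n − q·n − 1 − p·n ≥ −1. -/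
/-!
The key integer inequality in the inductive proof of the asymptotic vanishing theorem for
products of projective spaces: the degree `a_i = i·(d′+n) + d′ + b′ + 2n − qn − 1 − pn`
of a line bundle on `ℙ^1` appearing via the Künneth formula satisfies `a_i ≥ −1`, so that
`H^1(ℙ^1, O_{ℙ^1}(a_i)) = 0`.
-/

/-- Let `N, n, q, d, d′, b, b′, p, i` be integers with `N ≥ 1`, `n ≥ 1`, `q ≥ 3`, `d ≥ 1`,
`d′ ≥ d`, `b′ ≥ b`, `d + b ≥ 0`, `p ≥ 0`, `N·n!·p ≤ d^{q−1} + b·d^{q−2}` and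
`N·(n−1)!·(i − q + 1) ≥ d^{q−2} + b·d^{q−3}`.  Then
`i·(d′ + n) + d′ + b′ + 2n − q·n − 1 − p·n ≥ −1`. -/
theorem key_inequality
    (N n q d d' b b' p i : ℤ)
    (hN : 1 ≤ N) (hn : 1 ≤ n) (hq : 3 ≤ q) (hd : 1 ≤ d)
    (hd' : d ≤ d') (hb' : b ≤ b') (hdb : 0 ≤ d + b) (hp : 0 ≤ p)
    (h1 : N * (Nat.factorial n.toNat : ℤ) * p ≤ d ^ (q - 1).toNat + b * d ^ (q - 2).toNat)
    (h2 : d ^ (q - 2).toNat + b * d ^ (q - 3).toNat ≤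
      N * (Nat.factorial (n - 1).toNat : ℤ) * (i - q + 1)) :
    -1 ≤ i * (d' + n) + d' + b' + 2 * n - q * n - 1 - p * n := by
  obtain ⟨m, rfl⟩ : ∃ m : ℕ, n = m + 1 := ⟨(n - 1).toNat, by omega⟩
  obtain ⟨k, rfl⟩ : ∃ k : ℕ, q = k + 3 := ⟨(q - 3).toNat, by omega⟩
  rw [show ((m : ℤ) + 1).toNat = m + 1 by omega, show ((k : ℤ) + 3 - 1).toNat = k + 2 by omega,
    show ((k : ℤ) + 3 - 2).toNat = k + 1 by omega, Nat.factorial_succ] at h1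
  rw [show ((m : ℤ) + 1 - 1).toNat = m by omega, show ((k : ℤ) + 3 - 2).toNat = k + 1 by omega,
    show ((k : ℤ) + 3 - 3).toNat = k by omega] at h2
  push_cast at h1
  have hM : 0 < N * (m.factorial : ℤ) :=
    mul_pos (by omega) (by exact_mod_cast m.factorial_pos)
  obtain ⟨j, rfl⟩ : ∃ j, i = j + (k + 3) - 1 := ⟨i - (k + 3) + 1, by ring⟩
  rw [show j + ((k : ℤ) + 3) - 1 - (k + 3) + 1 = j by ring] at h2
  have hX : 0 ≤ d ^ (k + 1) + b * d ^ k := by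
    have : 0 ≤ d ^ k * (d + b) := by positivity
    linarith [show d ^ k * (d + b) = d ^ (k + 1) + b * d ^ k by ring]
  have hj : 0 ≤ j := nonneg_of_mul_nonneg_right (hX.trans h2) hM
  have hpj : ((m : ℤ) + 1) * p ≤ d * j := by
    refine le_of_mul_le_mul_left ?_ hM
    calc N * (m.factorial : ℤ) * ((m + 1) * p)
        = N * ((m + 1) * (m.factorial : ℤ)) * p := by ring
      _ ≤ d ^ (k + 2) + b * d ^ (k + 1) := h1
      _ = d * (d ^ (k + 1) + b * d ^ k) := by ring
      _ ≤ d * (N * (m.factorial : ℤ) * j) := by gcongr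
      _ = N * (m.factorial : ℤ) * (d * j) := by ring
  have hdj : d * j ≤ d' * j := by gcongr
  have hjn : 0 ≤ j * ((m : ℤ) + 1) := by positivity
  have hkd : 0 ≤ ((k : ℤ) + 2) * d' := mul_nonneg (by positivity) (by omega)
  linarith
end
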